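/- The function ω ↦ −log₂(5/4 − ω + √3·√((ω − 1/2)(1 − ω))) is convex on the interval [7/8, 1]. Consequently, for any p_s ∈ (7/8, 1), its first-order Taylor expansion at p_s is a lower bound: for all q ∈ [7/8,1], f(q) ≥ f(p_s) + (q − p_s)·f′(p_s). -/

import Mathlib

theorem ConcaveOn.comp_of_mapsTo {f g : ℝ → ℝ} {s t : Set ℝ} (hg : ConcaveOn ℝ t g)
    (hmono : MonotoneOn g t) (hf : ConcaveOn ℝ s f) (hst : Set.MapsTo f s t) :
    ConcaveOn ℝ s (fun x => g (f x)) :=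
  ⟨hf.1, fun _ hx _ hy _ _ ha hb hab =>
    (hg.2 (hst hx) (hst hy) ha hb hab).trans <|
      hmono (hg.1 (hst hx) (hst hy) ha hb hab) (hst (hf.1 hx hy ha hb hab))
        (hf.2 hx hy ha hb hab)⟩

/-- A convex function on a set of reals lies above its tangent line at a point of
differentiability. -/
theorem ConvexOn.tangent_line_le {f : ℝ → ℝ} {s : Set ℝ} (hf : ConvexOn ℝ s f) {p q : ℝ}
    (hp : p ∈ s) (hq : q ∈ s) (hd : DifferentiableAt ℝ f p) :
    f p + (q - p) * deriv f p ≤ f q := by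
  rcases lt_trichotomy p q with h | rfl | h
  · have := hf.deriv_le_slope hp hq h hd
    rw [slope_def_field, le_div_iff₀ (sub_pos.2 h)] at this
    linarith
  · simp
  · have := hf.slope_le_deriv hq hp h hd
    rw [slope_def_field, div_le_iff₀ (sub_pos.2 h)] at this
    linarith

theorem concaveOn_sub_half_mul_one_sub :
    ConcaveOn ℝ (Set.Icc (7/8 : ℝ) 1) (fun ω : ℝ => (ω - 1/2) * (1 - ω)) := by
  refine ⟨convex_Icc _ _, fun x _ y _ a b ha hb hab => ?_⟩
  obtain rfl : b = 1 - a := by linarith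
  simp only [smul_eq_mul]
  nlinarith [mul_nonneg (mul_nonneg ha hb) (sq_nonneg (x - y))]

theorem concaveOn_logb_argument :
    ConcaveOn ℝ (Set.Icc (7/8 : ℝ) 1)
      (fun ω : ℝ => 5/4 - ω + Real.sqrt 3 * Real.sqrt ((ω - 1/2) * (1 - ω))) := by
  have hsqrt : ConcaveOn ℝ (Set.Icc (7/8 : ℝ) 1)
      (fun ω : ℝ => Real.sqrt ((ω - 1/2) * (1 - ω))) :=
    Real.strictConcaveOn_sqrt.concaveOn.comp_of_mapsTo (fun _ _ _ _ h => Real.sqrt_le_sqrt h)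
      concaveOn_sub_half_mul_one_sub
      fun ω hω => mul_nonneg (sub_nonneg.2 (le_trans (by norm_num) hω.1)) (sub_nonneg.2 hω.2)
  exact ((concaveOn_const (5/4) (convex_Icc _ _)).sub (convexOn_id (convex_Icc _ _))).add
    (hsqrt.smul (Real.sqrt_nonneg 3))

theorem logb_argument_pos {ω : ℝ} (hω : ω ≤ 1) :
    0 < 5/4 - ω + Real.sqrt 3 * Real.sqrt ((ω - 1/2) * (1 - ω)) :=
  add_pos_of_pos_of_nonneg (by linarith) (by positivity)

theorem concaveOn_logb_Ioi {b : ℝ} (hb : 1 ≤ b) : ConcaveOn ℝ (Set.Ioi 0) (Real.logb b) := by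
  have h : Real.logb b = fun x => (Real.log b)⁻¹ • Real.log x := by
    ext x
    rw [Real.logb, div_eq_inv_mul, smul_eq_mul]
  rw [h]
  exact strictConcaveOn_log_Ioi.concaveOn.smul (inv_nonneg.2 (Real.log_nonneg hb))

/-- The function `ω ↦ -log₂(5/4 - ω + √3·√((ω-1/2)(1-ω)))` is convex on `[7/8, 1]`, and hence
lies above each of its tangent lines: for `p ∈ (7/8,1)` and `q ∈ [7/8,1]`,
`f(q) ≥ f(p) + (q-p)·f'(p)`. -/
theorem ghz_entropy_rate_convex :
    ConvexOn ℝ (Set.Icc (7/8 : ℝ) 1)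
      (fun ω : ℝ => -Real.logb 2 (5/4 - ω + Real.sqrt 3 * Real.sqrt ((ω - 1/2) * (1 - ω)))) ∧
    ∀ p ∈ Set.Ioo (7/8 : ℝ) 1, ∀ q ∈ Set.Icc (7/8 : ℝ) 1,
      (fun ω : ℝ => -Real.logb 2 (5/4 - ω + Real.sqrt 3 * Real.sqrt ((ω - 1/2) * (1 - ω)))) p
        + (q - p) * deriv
            (fun ω : ℝ => -Real.logb 2 (5/4 - ω + Real.sqrt 3 * Real.sqrt ((ω - 1/2) * (1 - ω)))) p
      ≤ (fun ω : ℝ => -Real.logb 2 (5/4 - ω + Real.sqrt 3 * Real.sqrt ((ω - 1/2) * (1 - ω)))) q := by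
  have hconv : ConvexOn ℝ (Set.Icc (7/8 : ℝ) 1)
      (fun ω : ℝ => -Real.logb 2 (5/4 - ω + Real.sqrt 3 * Real.sqrt ((ω - 1/2) * (1 - ω)))) :=
    ((concaveOn_logb_Ioi one_le_two).comp_of_mapsTo
      (fun _ hx _ _ h => Real.logb_le_logb_of_le one_lt_two hx h)
      concaveOn_logb_argument fun _ hω => logb_argument_pos hω.2).neg
  refine ⟨hconv, fun p hp q hq => hconv.tangent_line_le (Set.Ioo_subset_Icc_self hp) hq ?_⟩
  have hrad : (p - 1/2) * (1 - p) ≠ 0 :=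
    (mul_pos (by linarith [hp.1]) (by linarith [hp.2])).ne'
  have harg := (logb_argument_pos hp.2.le).ne'
  unfold Real.logb
  fun_prop (disch := assumption)
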